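/- Let n ≥ 2 be an integer and ξ a transcendental real number with ŵ_n(ξ) < ∞ and w_n(ξ) < ∞. For every ε > 0 there exists k_0 such that for every integer k ≥ k_0 satisfying H_k > 2·H_{k−1}, the integer ℓ = ℓ(k) is finite, the polynomials P_{k−1}, P_k, P_ℓ are linearly independent over ℚ, and log H_ℓ / log H_k ≤ ((w_n(ξ)/τ_k − 1)/(ŵ_n(ξ) − 1))·τ_ℓ + ε. -/

import Mathlib

open Polynomial Filter

noncomputable section

/-- Height of an integer polynomial: maximum absolute value of its coefficients. -/
def polyHeight (P : Polynomial ℤ) : ℕ :=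
  P.support.sup fun i => (P.coeff i).natAbs

/-- The set of exponents `w` admissible for the uniform exponent `ŵ_n(ξ)`. -/
def uniformExpSet (n : ℕ) (ξ : ℝ) : Set ℝ :=
  {w | ∀ᶠ X : ℝ in atTop, ∃ P : Polynomial ℤ, P.natDegree ≤ n ∧
    (polyHeight P : ℝ) ≤ X ∧ 0 < |Polynomial.aeval ξ P| ∧
    |Polynomial.aeval ξ P| < X ^ (-w)}

/-- The uniform exponent `ŵ_n(ξ)`, as an extended real. -/
def wHat (n : ℕ) (ξ : ℝ) : EReal :=
  sSup ((fun w : ℝ => (w : EReal)) '' uniformExpSet n ξ)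

/-- The set of exponents `w` admissible for the ordinary exponent `w_n(ξ)`. -/
def ordExpSet (n : ℕ) (ξ : ℝ) : Set ℝ :=
  {w | {P : Polynomial ℤ | P.natDegree ≤ n ∧ 0 < |Polynomial.aeval ξ P| ∧
      |Polynomial.aeval ξ P| < (polyHeight P : ℝ) ^ (-w)}.Infinite}

/-- The ordinary exponent `w_n(ξ)`, as an extended real. -/
def wOrd (n : ℕ) (ξ : ℝ) : EReal :=
  sSup ((fun w : ℝ => (w : EReal)) '' ordExpSet n ξ)

/-- `P` (1-indexed: the relevant values are `P 1, P 2, …`) is the sequence of best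
approximation polynomials associated to `(n, ξ)`. -/
structure IsBestApproxSeq (n : ℕ) (ξ : ℝ) (P : ℕ → Polynomial ℤ) : Prop where
  ne_zero : ∀ k, 1 ≤ k → P k ≠ 0
  deg_le : ∀ k, 1 ≤ k → (P k).natDegree ≤ n
  height_lt : ∀ k, 1 ≤ k → polyHeight (P k) < polyHeight (P (k+1))
  eval_lt : ∀ k, 1 ≤ k → |Polynomial.aeval ξ (P (k+1))| < |Polynomial.aeval ξ (P k)|
  isMin : ∀ k, 1 ≤ k → ∀ Q : Polynomial ℤ, Q ≠ 0 → Q.natDegree ≤ n →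
    polyHeight Q ≤ polyHeight (P k) →
    |Polynomial.aeval ξ (P k)| ≤ |Polynomial.aeval ξ Q|
  complete : ∀ Q : Polynomial ℤ, Q ≠ 0 → Q.natDegree ≤ n →
    (∀ R : Polynomial ℤ, R ≠ 0 → R.natDegree ≤ n → polyHeight R ≤ polyHeight Q →
      |Polynomial.aeval ξ Q| ≤ |Polynomial.aeval ξ R|) →
    ∃ k, 1 ≤ k ∧ (Q = P k ∨ Q = -P k)

/-- The image of an integer polynomial in `ℚ[X]`. -/
def ratPoly (P : Polynomial ℤ) : Polynomial ℚ := P.map (Int.castRingHom ℚ)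

/-- `k` is good for the sequence `P`: `P_{k-1}, P_k, P_{k+1}` are `ℚ`-linearly independent. -/
def Good (P : ℕ → Polynomial ℤ) (k : ℕ) : Prop :=
  LinearIndependent ℚ ![ratPoly (P (k-1)), ratPoly (P k), ratPoly (P (k+1))]

/-- `τ_k = log H_k / log H_{k-1}`. -/
def tauk (P : ℕ → Polynomial ℤ) (k : ℕ) : ℝ :=
  Real.log (polyHeight (P k)) / Real.log (polyHeight (P (k-1)))

/-- `μ_k = -log |P_{k-1}(ξ)| / log H_k`. -/
def muk (ξ : ℝ) (P : ℕ → Polynomial ℤ) (k : ℕ) : ℝ :=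
  - Real.log |Polynomial.aeval ξ (P (k-1))| / Real.log (polyHeight (P k))

/-- `v_k = -log |P_k(ξ)| / log H_k`. -/
def vk (ξ : ℝ) (P : ℕ → Polynomial ℤ) (k : ℕ) : ℝ :=
  - Real.log |Polynomial.aeval ξ (P k)| / Real.log (polyHeight (P k))

/-- The set of integers `m ≥ k+1` such that `P_{k-1}, …, P_{m-1}` all lie in the
two-dimensional space spanned by `P_{k-1}` and `P_k`; its greatest element is `ℓ(k)`. -/
def ellSet (P : ℕ → Polynomial ℤ) (k : ℕ) : Set ℕ :=
  {m | k + 1 ≤ m ∧ ∀ j, k - 1 ≤ j → j ≤ m - 1 →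
    ratPoly (P j) ∈ Submodule.span ℚ {ratPoly (P (k-1)), ratPoly (P k)}}

/-- The set `V_k = {P, T·P, …, T^{n-2}·P}` (as rational polynomials). -/
def Vset (n : ℕ) (A : Polynomial ℤ) : Set (Polynomial ℚ) :=
  {q | ∃ i ≤ n - 2, q = Polynomial.X ^ i * ratPoly A}

/-- The trajectory `L_P(q) = max(log H(P) - q/(2n-2), log |P(ξ)| + q)`. -/
def LPtraj (n : ℕ) (ξ : ℝ) (Q : Polynomial ℤ) (q : ℝ) : ℝ :=
  max (Real.log (polyHeight Q) - q / (2*(n:ℝ)-2)) (Real.log |Polynomial.aeval ξ Q| + q)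

/-- The `j`-th successive minimum function `L_j(q)`: the infimum over sets of `j`
linearly independent integer polynomials of degree at most `2n-2` of the maximum of
`L_P(q)` over the set. -/
def Lj (n : ℕ) (ξ : ℝ) (j : ℕ) (q : ℝ) : ℝ :=
  sInf {y : ℝ | ∃ S : Finset (Polynomial ℤ), S.card = j ∧
    (∀ Q ∈ S, Q.natDegree ≤ 2*n-2) ∧
    LinearIndependent ℚ (fun Q : {x // x ∈ S} => ratPoly (Q : Polynomial ℤ)) ∧
    y = sSup ((fun Q => LPtraj n ξ Q q) '' (S : Set (Polynomial ℤ)))}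

theorem natAbs_coeff_le_polyHeight (Q : Polynomial ℤ) (i : ℕ) :
    (Q.coeff i).natAbs ≤ polyHeight Q := by
  by_cases h : i ∈ Q.support
  · exact Finset.le_sup (f := fun i => (Q.coeff i).natAbs) h
  · simp [notMem_support_iff.mp h]

theorem abs_coeff_le_polyHeight (Q : Polynomial ℤ) (i : ℕ) :
    |(Q.coeff i : ℝ)| ≤ polyHeight Q := by
  rw [← Int.cast_abs, Int.abs_eq_natAbs]
  exact_mod_cast natAbs_coeff_le_polyHeight Q i

theorem polyHeight_le_of_abs_coeff_le {Q : Polynomial ℤ} {X : ℝ} (hX : 0 ≤ X)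
    (h : ∀ i, |(Q.coeff i : ℝ)| ≤ X) : (polyHeight Q : ℝ) ≤ X := by
  rw [← Nat.le_floor_iff hX]
  refine Finset.sup_le fun i _ => ?_
  rw [Nat.le_floor_iff hX]
  simpa [Nat.cast_natAbs] using h i

theorem polyHeight_pos {Q : Polynomial ℤ} (hQ : Q ≠ 0) : 0 < polyHeight Q :=
  (Int.natAbs_pos.mpr (leadingCoeff_ne_zero.mpr hQ)).trans_le
    (natAbs_coeff_le_polyHeight Q Q.natDegree)

theorem exists_abs_coeff_eq_polyHeight {Q : Polynomial ℤ} (hQ : Q ≠ 0) :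
    ∃ i, |(Q.coeff i : ℝ)| = polyHeight Q := by
  obtain ⟨i, -, hi⟩ := Finset.exists_mem_eq_sup Q.support
    (support_nonempty.mpr hQ) fun i => (Q.coeff i).natAbs
  refine ⟨i, ?_⟩
  rw [polyHeight, hi, Nat.cast_natAbs, Int.cast_abs]

theorem aeval_ne_zero_of_transcendental {ξ : ℝ} (hξ : Transcendental ℚ ξ)
    {Q : Polynomial ℤ} (hQ : Q ≠ 0) : aeval ξ Q ≠ 0 := by
  refine fun h => hξ ⟨ratPoly Q, ?_, (aeval_map_algebraMap ℚ ξ Q).trans h⟩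
  exact (Polynomial.map_ne_zero_iff Int.cast_injective).mpr hQ

theorem finite_natDegree_le_polyHeight_le (n h : ℕ) :
    {Q : Polynomial ℤ | Q.natDegree ≤ n ∧ polyHeight Q ≤ h}.Finite := by
  refine Set.Finite.of_finite_image (f := fun Q (i : Fin (n + 1)) => Q.coeff i)
    ((Set.Finite.pi fun _ => Set.finite_Icc (-(h : ℤ)) h).subset ?_) ?_
  · rintro _ ⟨Q, ⟨-, hQ⟩, rfl⟩ i -
    have := (natAbs_coeff_le_polyHeight Q i).trans hQ
    simp only [Set.mem_Icc]
    omega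
  · intro Q hQ R hR hQR
    ext i
    by_cases hi : i < n + 1
    · exact congrFun hQR ⟨i, hi⟩
    · rw [coeff_eq_zero_of_natDegree_lt (by have := hQ.1; omega),
        coeff_eq_zero_of_natDegree_lt (by have := hR.1; omega)]

namespace IsBestApproxSeq

variable {n : ℕ} {ξ : ℝ} {P : ℕ → Polynomial ℤ}

theorem height_strictMono (hP : IsBestApproxSeq n ξ P) {i j : ℕ} (hi : 1 ≤ i) (hij : i < j) :
    polyHeight (P i) < polyHeight (P j) := by
  induction j, hij using Nat.le_induction with
  | base => exact hP.height_lt i hi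
  | succ j hj ih => exact ih.trans (hP.height_lt j (by omega))

theorem eval_strictAnti (hP : IsBestApproxSeq n ξ P) {i j : ℕ} (hi : 1 ≤ i) (hij : i < j) :
    |aeval ξ (P j)| < |aeval ξ (P i)| := by
  induction j, hij using Nat.le_induction with
  | base => exact hP.eval_lt i hi
  | succ j hj ih => exact (hP.eval_lt j (by omega)).trans ih

theorem le_height (hP : IsBestApproxSeq n ξ P) {j : ℕ} (hj : 1 ≤ j) :
    j ≤ polyHeight (P j) := by
  induction j, hj using Nat.le_induction with
  | base => exact polyHeight_pos (hP.ne_zero 1 le_rfl)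
  | succ j hj ih => exact ih.trans_lt (hP.height_lt j hj)

theorem log_height_mono (hP : IsBestApproxSeq n ξ P) {i j : ℕ} (hi : 1 ≤ i) (hij : i ≤ j) :
    Real.log (polyHeight (P i)) ≤ Real.log (polyHeight (P j)) := by
  have hpos := polyHeight_pos (hP.ne_zero i hi)
  refine Real.log_le_log (by exact_mod_cast hpos) ?_
  rcases hij.eq_or_lt with rfl | h
  · exact le_rfl
  · exact_mod_cast (hP.height_strictMono hi h).le

theorem tendsto_log_height (hP : IsBestApproxSeq n ξ P) :
    Tendsto (fun j => Real.log (polyHeight (P j))) atTop atTop := by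
  refine Real.tendsto_log_atTop.comp (tendsto_atTop_mono' atTop ?_ tendsto_natCast_atTop_atTop)
  filter_upwards [eventually_ge_atTop 1] with j hj
  exact_mod_cast hP.le_height hj

/-- A nonzero polynomial of height less than `H_{j+1}` takes at `ξ` a value at least as
large as `P_j` does. -/
theorem eval_le_of_height_lt (hP : IsBestApproxSeq n ξ P) {j : ℕ} (hj : 1 ≤ j)
    {Q : Polynomial ℤ} (hQ : Q ≠ 0) (hdeg : Q.natDegree ≤ n)
    (hlt : polyHeight Q < polyHeight (P (j + 1))) :
    |aeval ξ (P j)| ≤ |aeval ξ Q| := by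
  obtain ⟨R, ⟨⟨hRd, hRh⟩, hR0⟩, hRmin⟩ := Set.exists_min_image
    ({R : Polynomial ℤ | R.natDegree ≤ n ∧ polyHeight R ≤ polyHeight Q} ∩ {R | R ≠ 0})
    (fun R => |aeval ξ R|) ((finite_natDegree_le_polyHeight_le n _).inter_of_left _)
    ⟨Q, ⟨hdeg, le_rfl⟩, hQ⟩
  obtain ⟨m, hm, hRm⟩ := hP.complete R hR0 hRd fun S hS0 hSd hSh =>
    hRmin S ⟨⟨hSd, hSh.trans hRh⟩, hS0⟩
  have habs : |aeval ξ R| = |aeval ξ (P m)| := by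
    rcases hRm with rfl | rfl <;> simp
  have hheight : polyHeight R = polyHeight (P m) := by
    rcases hRm with rfl | rfl <;> simp [polyHeight]
  have hmj : m ≤ j := by
    by_contra! h
    rcases (Nat.succ_le_of_lt h).eq_or_lt with h | h
    · rw [Nat.succ_eq_add_one] at h; subst h; omega
    · have := hP.height_strictMono (by omega) h
      rw [Nat.succ_eq_add_one] at this
      omega
  refine le_trans ?_ (hRmin Q ⟨⟨hdeg, le_rfl⟩, hQ⟩)
  rw [habs]
  rcases hmj.eq_or_lt with rfl | h
  · exact le_rfl
  · exact (hP.eval_strictAnti hm h).le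

theorem eq_zero_of_int_combination (hP : IsBestApproxSeq n ξ P) (hξ : Transcendental ℚ ξ)
    {j : ℕ} (hj : 1 ≤ j) {a b : ℤ} (h : C a * P j + C b * P (j + 1) = 0) : a = 0 ∧ b = 0 := by
  have heval : (a : ℝ) * aeval ξ (P j) + b * aeval ξ (P (j + 1)) = 0 := by
    simpa using congrArg (aeval ξ) h
  have hlt := hP.eval_lt j hj
  have hpos : 0 < |aeval ξ (P (j + 1))| :=
    abs_pos.mpr (aeval_ne_zero_of_transcendental hξ (hP.ne_zero _ (by omega)))
  have heq : |(a : ℝ)| * |aeval ξ (P j)| = |(b : ℝ)| * |aeval ξ (P (j + 1))| := by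
    rw [← abs_mul, ← abs_mul, eq_neg_of_add_eq_zero_left heval, abs_neg]
  obtain ⟨i, hi⟩ := exists_abs_coeff_eq_polyHeight (hP.ne_zero (j + 1) (by omega))
  have hcoeff : (a : ℝ) * (P j).coeff i + b * (P (j + 1)).coeff i = 0 := by
    have := congrArg (fun Q : Polynomial ℤ => (Q.coeff i : ℝ)) h
    simpa using this
  have hceq : |(a : ℝ)| * |((P j).coeff i : ℝ)| = |(b : ℝ)| * polyHeight (P (j + 1)) := by
    rw [← hi, ← abs_mul, ← abs_mul, eq_neg_of_add_eq_zero_left hcoeff, abs_neg]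
  have hcle := abs_coeff_le_polyHeight (P j) i
  have hh : (polyHeight (P j) : ℝ) < polyHeight (P (j + 1)) := by
    exact_mod_cast hP.height_lt j hj
  have hh0 : (0 : ℝ) ≤ polyHeight (P j) := Nat.cast_nonneg _
  have hba : |(b : ℝ)| ≤ |(a : ℝ)| := by
    by_contra! hab
    have h0 := abs_nonneg (a : ℝ)
    nlinarith
  have ha : |(a : ℝ)| = 0 := by
    by_contra hne
    have h0 : 0 < |(a : ℝ)| := lt_of_le_of_ne (abs_nonneg _) (Ne.symm hne)
    nlinarith
  have hb : |(b : ℝ)| = 0 := le_antisymm (ha ▸ hba) (abs_nonneg _)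
  exact ⟨by simpa using ha, by simpa using hb⟩

/-- Consecutive best approximations generate the lattice of integer polynomials in the
rational plane that they span. -/
theorem exists_int_combination (hP : IsBestApproxSeq n ξ P) {j : ℕ} (hj : 1 ≤ j)
    {Q : Polynomial ℤ} (hdeg : Q.natDegree ≤ n)
    (hQ : ratPoly Q ∈ Submodule.span ℚ {ratPoly (P j), ratPoly (P (j + 1))}) :
    ∃ x y : ℤ, Q = C x * P j + C y * P (j + 1) := by
  obtain ⟨x, y, hxy⟩ := Submodule.mem_span_pair.mp hQ
  refine ⟨round x, round y, ?_⟩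
  set R := Q - (C (round x) * P j + C (round y) * P (j + 1)) with hR
  suffices R = 0 from sub_eq_zero.mp this
  have hcQ (i : ℕ) :
      (Q.coeff i : ℝ) = (x : ℝ) * (P j).coeff i + (y : ℝ) * (P (j + 1)).coeff i := by
    have := congrArg (fun p : Polynomial ℚ => ((p.coeff i : ℚ) : ℝ)) hxy
    simpa [ratPoly] using this.symm
  have hratPoly (S : Polynomial ℤ) : aeval ξ (ratPoly S) = aeval ξ S :=
    aeval_map_algebraMap (A := ℚ) ξ S
  have heQ : aeval ξ Q = (x : ℝ) * aeval ξ (P j) + (y : ℝ) * aeval ξ (P (j + 1)) := by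
    have := congrArg (aeval ξ) hxy
    simp only [map_add, map_smul, hratPoly, Rat.smul_def] at this
    exact this.symm
  have hx : |(x : ℝ) - (round x : ℤ)| ≤ 1 / 2 := by
    have := (Rat.cast_le (K := ℝ)).mpr (abs_sub_round x)
    push_cast at this
    exact this
  have hy : |(y : ℝ) - (round y : ℤ)| ≤ 1 / 2 := by
    have := (Rat.cast_le (K := ℝ)).mpr (abs_sub_round y)
    push_cast at this
    exact this
  have hbound (s t : ℝ) : |((x : ℝ) - (round x : ℤ)) * s + ((y : ℝ) - (round y : ℤ)) * t| ≤
      (|s| + |t|) / 2 := by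
    refine (abs_add_le _ _).trans ?_
    rw [abs_mul, abs_mul]
    nlinarith [abs_nonneg s, abs_nonneg t]
  have hh : (polyHeight (P j) : ℝ) < polyHeight (P (j + 1)) := by
    exact_mod_cast hP.height_lt j hj
  have hRh : (polyHeight R : ℝ) ≤ (polyHeight (P j) + polyHeight (P (j + 1))) / 2 := by
    refine polyHeight_le_of_abs_coeff_le (by positivity) fun i => ?_
    have hc : (R.coeff i : ℝ) = ((x : ℝ) - (round x : ℤ)) * (P j).coeff i +
        ((y : ℝ) - (round y : ℤ)) * (P (j + 1)).coeff i := by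
      simp only [hR, coeff_sub, coeff_add, coeff_C_mul, Int.cast_sub, Int.cast_add, Int.cast_mul,
        hcQ]
      ring
    rw [hc]
    linarith [hbound ((P j).coeff i) ((P (j + 1)).coeff i), abs_coeff_le_polyHeight (P j) i,
      abs_coeff_le_polyHeight (P (j + 1)) i]
  have hRe : |aeval ξ R| ≤ (|aeval ξ (P j)| + |aeval ξ (P (j + 1))|) / 2 := by
    convert hbound (aeval ξ (P j)) (aeval ξ (P (j + 1))) using 2
    simp [hR, heQ]
    ring
  by_contra hR0
  have hRdeg : R.natDegree ≤ n :=
    (natDegree_sub_le _ _).trans (max_le hdeg ((natDegree_add_le _ _).trans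
      (max_le ((natDegree_C_mul_le _ _).trans (hP.deg_le j hj))
        ((natDegree_C_mul_le _ _).trans (hP.deg_le _ (by omega))))))
  have hRlt : polyHeight R < polyHeight (P (j + 1)) := by
    have : (polyHeight R : ℝ) < polyHeight (P (j + 1)) := by linarith
    exact_mod_cast this
  linarith [hP.eval_le_of_height_lt hj hR0 hRdeg hRlt, hP.eval_lt j hj]

/-- If `P_m, P_{m+1}` lie in the plane of `P_j, P_{j+1}` and `H_{j+1} > 2 H_j`, then
`|P_j(ξ)| H_{j+1}` is at most four times `|P_m(ξ)| H_{m+1}`. -/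
theorem eval_mul_height_le (hP : IsBestApproxSeq n ξ P) (hξ : Transcendental ℚ ξ)
    {j m : ℕ} (hj : 1 ≤ j) (hm : 1 ≤ m)
    (hgap : 2 * polyHeight (P j) < polyHeight (P (j + 1)))
    (h₁ : ratPoly (P m) ∈ Submodule.span ℚ {ratPoly (P j), ratPoly (P (j + 1))})
    (h₂ : ratPoly (P (m + 1)) ∈ Submodule.span ℚ {ratPoly (P j), ratPoly (P (j + 1))}) :
    |aeval ξ (P j)| * polyHeight (P (j + 1)) ≤
      4 * (|aeval ξ (P m)| * polyHeight (P (m + 1))) := by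
  obtain ⟨x, y, hxy⟩ := hP.exists_int_combination hj (hP.deg_le m hm) h₁
  obtain ⟨z, t, hzt⟩ := hP.exists_int_combination hj (hP.deg_le (m + 1) (by omega)) h₂
  have hdet : x * t - y * z ≠ 0 := by
    intro hdet
    have hC : (C x * C t - C y * C z : Polynomial ℤ) = 0 := by
      rw [← C_mul, ← C_mul, ← C_sub, hdet, C_0]
    have e₁ := hP.eq_zero_of_int_combination hξ hm (a := t) (b := -y) (by
      rw [hxy, hzt, C_neg]; linear_combination (P j) * hC)
    have e₂ := hP.eq_zero_of_int_combination hξ hm (a := z) (b := -x) (by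
      rw [hxy, hzt, C_neg]; linear_combination (-P (j + 1)) * hC)
    apply hP.ne_zero m hm
    rw [hxy, neg_eq_zero.mp e₁.2, neg_eq_zero.mp e₂.2]
    simp
  obtain ⟨i, hi⟩ := exists_abs_coeff_eq_polyHeight (hP.ne_zero (j + 1) (by omega))
  have hlower : |aeval ξ (P j)| * polyHeight (P (j + 1)) / 2 ≤
      |aeval ξ (P j) * (P (j + 1)).coeff i - aeval ξ (P (j + 1)) * (P j).coeff i| := by
    have h := abs_sub_abs_le_abs_sub (aeval ξ (P j) * (P (j + 1)).coeff i)
      (aeval ξ (P (j + 1)) * (P j).coeff i)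
    rw [abs_mul, abs_mul, hi] at h
    have hg : 2 * (polyHeight (P j) : ℝ) ≤ polyHeight (P (j + 1)) := by exact_mod_cast hgap.le
    have hp := mul_le_mul (hP.eval_lt j hj).le (abs_coeff_le_polyHeight (P j) i)
      (abs_nonneg _) (abs_nonneg _)
    nlinarith [abs_nonneg (aeval ξ (P j))]
  have hupper : |aeval ξ (P m) * (P (m + 1)).coeff i - aeval ξ (P (m + 1)) * (P m).coeff i| ≤
      2 * (|aeval ξ (P m)| * polyHeight (P (m + 1))) := by
    have h := abs_sub (aeval ξ (P m) * (P (m + 1)).coeff i)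
      (aeval ξ (P (m + 1)) * (P m).coeff i)
    rw [abs_mul, abs_mul] at h
    have hp := mul_le_mul_of_nonneg_left (abs_coeff_le_polyHeight (P (m + 1)) i)
      (abs_nonneg (aeval ξ (P m)))
    have hq := mul_le_mul (hP.eval_lt m hm).le ((abs_coeff_le_polyHeight (P m) i).trans
      (Nat.cast_le.mpr (hP.height_lt m hm).le)) (abs_nonneg _) (abs_nonneg _)
    linarith
  have hrel : aeval ξ (P m) * (P (m + 1)).coeff i - aeval ξ (P (m + 1)) * (P m).coeff i =
      ((x * t - y * z : ℤ) : ℝ) *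
        (aeval ξ (P j) * (P (j + 1)).coeff i - aeval ξ (P (j + 1)) * (P j).coeff i) := by
    rw [hzt, hxy]
    simp
    ring
  have hone : (1 : ℝ) ≤ |((x * t - y * z : ℤ) : ℝ)| := by
    exact_mod_cast Int.one_le_abs hdet
  rw [hrel, abs_mul] at hupper
  nlinarith [abs_nonneg
    (aeval ξ (P j) * (P (j + 1)).coeff i - aeval ξ (P (j + 1)) * (P j).coeff i)]

/-- `|P_j(ξ)| ≥ H_j ^ (-w)` for large `j` and `w > w_n(ξ)`, in logarithmic form. -/
theorem eventually_neg_log_eval_le (hP : IsBestApproxSeq n ξ P) (hξ : Transcendental ℚ ξ)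
    (hfin : wOrd n ξ < ⊤) {w : ℝ} (hw : (wOrd n ξ).toReal < w) :
    ∀ᶠ j in atTop, -Real.log |aeval ξ (P j)| ≤ w * Real.log (polyHeight (P j)) := by
  have hnot : w ∉ ordExpSet n ξ := by
    intro hmem
    have hle : (w : EReal) ≤ wOrd n ξ := le_sSup ⟨w, hmem, rfl⟩
    have := EReal.toReal_le_toReal hle (EReal.coe_ne_bot w) hfin.ne
    rw [EReal.toReal_coe] at this
    linarith
  have hset := Set.not_infinite.mp hnot
  have hinj : Set.InjOn P {j | 1 ≤ j} := by
    intro i hi j hj hij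
    by_contra hne
    rcases lt_or_gt_of_ne hne with h | h
    · exact (hP.height_strictMono hi h).ne (by rw [hij])
    · exact (hP.height_strictMono hj h).ne (by rw [hij])
  have hfinite : {j | 1 ≤ j ∧ |aeval ξ (P j)| < (polyHeight (P j) : ℝ) ^ (-w)}.Finite := by
    refine Set.Finite.of_finite_image (f := P) (hset.subset ?_) (hinj.mono fun j hj => hj.1)
    rintro _ ⟨j, ⟨hj, hlt⟩, rfl⟩
    exact ⟨hP.deg_le j hj,
      abs_pos.mpr (aeval_ne_zero_of_transcendental hξ (hP.ne_zero j hj)), hlt⟩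
  have hev := hfinite.compl_mem_cofinite
  rw [Nat.cofinite_eq_atTop] at hev
  filter_upwards [hev, eventually_ge_atTop 1] with j hj hj1
  have hle : (polyHeight (P j) : ℝ) ^ (-w) ≤ |aeval ξ (P j)| :=
    not_lt.mp fun h => hj ⟨hj1, h⟩
  have hpos : (0 : ℝ) < polyHeight (P j) := by
    exact_mod_cast polyHeight_pos (hP.ne_zero j hj1)
  have := Real.log_le_log (Real.rpow_pos_of_pos hpos _) hle
  rw [Real.log_rpow hpos] at this
  linarith

/-- `|P_j(ξ)| ≤ H_{j+1} ^ (-w)` for large `j` and `0 < w < ŵ_n(ξ)`, in logarithmic form. -/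
theorem eventually_le_neg_log_eval (hP : IsBestApproxSeq n ξ P) (hξ : Transcendental ℚ ξ)
    {w : ℝ} (hw0 : 0 < w) (hw : (w : EReal) < wHat n ξ) :
    ∀ᶠ j in atTop, w * Real.log (polyHeight (P (j + 1))) ≤ -Real.log |aeval ξ (P j)| := by
  obtain ⟨_, ⟨v, hv, rfl⟩, hwv⟩ := lt_sSup_iff.mp hw
  have hwv : w < v := EReal.coe_lt_coe_iff.mp hwv
  have htend : Tendsto (fun j => (polyHeight (P (j + 1)) : ℝ) - 1) atTop atTop := by
    refine tendsto_atTop_mono' atTop ?_ tendsto_natCast_atTop_atTop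
    filter_upwards [eventually_ge_atTop 1] with j hj
    have := hP.le_height (j := j + 1) (by omega)
    have : (((j + 1 : ℕ)) : ℝ) ≤ polyHeight (P (j + 1)) := by exact_mod_cast this
    push_cast at this
    linarith
  have hlog := ((tendsto_add_atTop_iff_nat 1).mpr hP.tendsto_log_height).eventually_ge_atTop
    (v * Real.log 2 / (v - w))
  filter_upwards [htend.eventually hv, htend.eventually_ge_atTop 1, hlog,
    eventually_ge_atTop 1] with j ⟨Q, hdeg, hh, hpos, hlt⟩ hge hL hj
  have hQ : Q ≠ 0 := by
    rintro rfl
    simp at hpos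
  have hQlt : polyHeight Q < polyHeight (P (j + 1)) := by
    have : (polyHeight Q : ℝ) < polyHeight (P (j + 1)) := by linarith
    exact_mod_cast this
  have hle := (hP.eval_le_of_height_lt hj hQ hdeg hQlt).trans hlt.le
  have h1 := Real.log_le_log
    (abs_pos.mpr (aeval_ne_zero_of_transcendental hξ (hP.ne_zero j hj))) hle
  rw [Real.log_rpow (by linarith)] at h1
  have h2 : Real.log (polyHeight (P (j + 1))) - Real.log 2 ≤
      Real.log ((polyHeight (P (j + 1)) : ℝ) - 1) := by
    rw [← Real.log_div (by linarith) two_ne_zero]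
    exact Real.log_le_log (by linarith) (by linarith)
  rw [div_le_iff₀ (by linarith)] at hL
  nlinarith

end IsBestApproxSeq

/-- Dirichlet's box principle for quadratic polynomials. -/
theorem exists_quadratic_abs_aeval_lt {ξ : ℝ} {N S M : ℕ} (hS : 0 < S)
    (hM : 1 + |ξ| + ξ ^ 2 ≤ M) (hcard : 2 * (N * M * S) + 1 < (N + 1) ^ 3) :
    ∃ Q : Polynomial ℤ, Q ≠ 0 ∧ Q.natDegree ≤ 2 ∧ polyHeight Q ≤ N ∧
      |aeval ξ Q| < 1 / S := by
  set f : ℕ × ℕ × ℕ → ℝ := fun p => p.1 + p.2.1 * ξ + p.2.2 * ξ ^ 2 with hf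
  set s : Finset (ℕ × ℕ × ℕ) :=
    Finset.range (N + 1) ×ˢ Finset.range (N + 1) ×ˢ Finset.range (N + 1) with hs
  set K : ℤ := N * M * S with hK
  have hmaps : Set.MapsTo (fun p => ⌊f p * S⌋) s (Finset.Icc (-K) K) := by
    rintro ⟨a, b, c⟩ hp
    simp only [hs, Finset.coe_product, Set.mem_prod, Finset.mem_coe, Finset.mem_range] at hp
    obtain ⟨ha, hb, hc⟩ := hp
    have ha' : (a : ℝ) ≤ N := by exact_mod_cast Nat.lt_succ_iff.mp ha
    have hb' : (b : ℝ) ≤ N := by exact_mod_cast Nat.lt_succ_iff.mp hb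
    have hc' : (c : ℝ) ≤ N := by exact_mod_cast Nat.lt_succ_iff.mp hc
    have habs : |f (a, b, c)| ≤ N * M := by
      calc |f (a, b, c)| ≤ |(a : ℝ)| + |(b : ℝ) * ξ| + |(c : ℝ) * ξ ^ 2| := abs_add_three _ _ _
        _ = a + b * |ξ| + c * ξ ^ 2 := by simp [abs_mul]
        _ ≤ N + N * |ξ| + N * ξ ^ 2 := by gcongr
        _ = N * (1 + |ξ| + ξ ^ 2) := by ring
        _ ≤ N * M := by gcongr
    have hS0 : (0 : ℝ) ≤ S := Nat.cast_nonneg S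
    obtain ⟨h1, h2⟩ := abs_le.mp habs
    simp only [Finset.coe_Icc, Set.mem_Icc]
    constructor
    · rw [Int.le_floor, hK]
      push_cast
      nlinarith
    · refine Int.floor_le_iff.mpr ?_
      rw [hK]
      push_cast
      nlinarith
  have hcard' : (Finset.Icc (-K) K).card < s.card := by
    rw [Int.card_Icc, hs, Finset.card_product, Finset.card_product, Finset.card_range]
    have hK' : K = ((N * M * S : ℕ) : ℤ) := by rw [hK]; push_cast; ring
    rw [hK']
    calc (((N * M * S : ℕ) : ℤ) + 1 - -((N * M * S : ℕ) : ℤ)).toNat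
        = 2 * (N * M * S) + 1 := by omega
      _ < (N + 1) ^ 3 := hcard
      _ = (N + 1) * ((N + 1) * (N + 1)) := by ring
  obtain ⟨⟨a, b, c⟩, hp, ⟨a', b', c'⟩, hq, hne, heq⟩ :=
    Finset.exists_ne_map_eq_of_card_lt_of_maps_to hcard' hmaps
  simp only [hs, Finset.mem_product, Finset.mem_range] at hp hq
  set Q : Polynomial ℤ := C ((a : ℤ) - a') + C ((b : ℤ) - b') * X + C ((c : ℤ) - c') * X ^ 2
    with hQ
  have hc0 : Q.coeff 0 = (a : ℤ) - a' := by simp [hQ]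
  have hc1 : Q.coeff 1 = (b : ℤ) - b' := by
    rw [hQ]; simp only [coeff_add, coeff_C_mul, coeff_X, coeff_C, coeff_X_pow]; simp
  have hc2 : Q.coeff 2 = (c : ℤ) - c' := by
    rw [hQ]; simp only [coeff_add, coeff_C_mul, coeff_X, coeff_C, coeff_X_pow]; simp
  have hdeg : Q.natDegree ≤ 2 := by rw [hQ]; compute_degree
  refine ⟨Q, ?_, hdeg, ?_, ?_⟩
  · intro h0
    rw [h0, coeff_zero] at hc0 hc1 hc2
    apply hne
    simp only [Prod.mk.injEq]
    omega
  · refine Finset.sup_le fun i hi => ?_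
    have hi2 : i ≤ 2 := (le_natDegree_of_mem_supp i hi).trans hdeg
    interval_cases i <;> omega
  · have h := Int.abs_sub_lt_one_of_floor_eq_floor heq
    have hS0 : (0 : ℝ) < S := by exact_mod_cast hS
    have hval : aeval ξ Q = f (a, b, c) - f (a', b', c') := by
      simp [hQ, hf]
      ring
    rw [lt_div_iff₀ hS0, hval]
    rwa [← sub_mul, abs_mul, abs_of_pos hS0] at h

theorem three_halves_mem_uniformExpSet {n : ℕ} (hn : 2 ≤ n) {ξ : ℝ}
    (hξ : Transcendental ℚ ξ) : (3 / 2 : ℝ) ∈ uniformExpSet n ξ := by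
  obtain ⟨M, hM⟩ := exists_nat_ge (1 + |ξ| + ξ ^ 2)
  have hM1 : (1 : ℝ) ≤ M := by nlinarith [abs_nonneg ξ, sq_nonneg ξ]
  filter_upwards [eventually_ge_atTop (((4 * M + 3 : ℝ)) ^ 2)] with X hX
  set y := √X with hy
  have hX0 : 0 ≤ X := (sq_nonneg _).trans hX
  have hyX : y ^ 2 = X := Real.sq_sqrt hX0
  have hy4 : 4 * (M : ℝ) + 3 ≤ y := Real.le_sqrt_of_sq_le hX
  have hpow : X ^ (3 / 2 : ℝ) = y ^ 3 := by
    rw [hy, Real.sqrt_eq_rpow, ← Real.rpow_natCast, ← Real.rpow_mul hX0]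
    norm_num
  have hy3 : 0 < y ^ 3 := pow_pos (by linarith) 3
  have hSpos : 0 < ⌈y ^ 3⌉₊ := Nat.ceil_pos.mpr hy3
  have hcard : 2 * (⌊X⌋₊ * M * ⌈y ^ 3⌉₊) + 1 < (⌊X⌋₊ + 1) ^ 3 := by
    have hN : (⌊X⌋₊ : ℝ) ≤ y ^ 2 := (Nat.floor_le hX0).trans_eq hyX.symm
    have hN' : y ^ 2 < ⌊X⌋₊ + 1 := hyX.trans_lt (Nat.lt_floor_add_one X)
    have hS : (⌈y ^ 3⌉₊ : ℝ) ≤ y ^ 3 + 1 := (Nat.ceil_lt_add_one hy3.le).le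
    have hreal : 2 * ((⌊X⌋₊ : ℝ) * M * ⌈y ^ 3⌉₊) + 1 < ((⌊X⌋₊ : ℝ) + 1) ^ 3 := by
      have hy1 : (1 : ℝ) ≤ y := by linarith
      have h1 : 1 ≤ y ^ 3 := one_le_pow₀ hy1
      have h5 : 1 ≤ y ^ 5 := one_le_pow₀ hy1
      calc 2 * ((⌊X⌋₊ : ℝ) * M * ⌈y ^ 3⌉₊) + 1 ≤ 2 * (y ^ 2 * M * (y ^ 3 + 1)) + 1 := by gcongr
        _ ≤ 2 * (y ^ 2 * M * (y ^ 3 + y ^ 3)) + y ^ 5 := by gcongr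
        _ = (4 * M + 1) * y ^ 5 := by ring
        _ < y * y ^ 5 := by gcongr; linarith
        _ = (y ^ 2) ^ 3 := by ring
        _ ≤ ((⌊X⌋₊ : ℝ) + 1) ^ 3 := by gcongr
    exact_mod_cast hreal
  obtain ⟨Q, hQ, hdeg, hh, hlt⟩ := exists_quadratic_abs_aeval_lt hSpos hM hcard
  refine ⟨Q, hdeg.trans hn, (Nat.cast_le.mpr hh).trans (Nat.floor_le hX0),
    abs_pos.mpr (aeval_ne_zero_of_transcendental hξ hQ), hlt.trans_le ?_⟩
  rw [Real.rpow_neg hX0, hpow, ← one_div]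
  exact one_div_le_one_div_of_le hy3 (Nat.le_ceil _)

/-- The elementary estimate that turns the two exponent inequalities between the logarithms
`a ≤ b ≤ c` and `d` of four heights into a bound for `d / b`. -/
theorem log_ratio_le_of_exponent_bounds {W V δ a b c d ε : ℝ} (hV : 3 / 2 ≤ V) (hδ : 0 < δ)
    (hδ4 : δ ≤ 1 / 4) (hδε : 2 * (|W| + 2) * (2 + 4 * (|W| + 2)) * δ ≤ ε)
    (ha : 0 < a) (hab : a ≤ b) (hbc : b ≤ c) (hd : 0 ≤ d) (hlog : Real.log 4 ≤ δ * b)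
    (h₁ : (V - 1 - δ) * c ≤ (W + δ) * a - b + Real.log 4) (h₂ : (V - δ) * d ≤ (W + δ) * c) :
    d / b ≤ ((W / (b / a) - 1) / (V - 1)) * (d / c) + ε := by
  set M := |W| + 2 with hM
  have hM2 : 2 ≤ M := by linarith [abs_nonneg W]
  have hW : W + δ ≤ M := by linarith [le_abs_self W]
  have hb : 0 < b := ha.trans_le hab
  have hc : 0 < c := hb.trans_le hbc
  have hdc : d ≤ M * c := by nlinarith
  have hcb : c ≤ 4 * M * b := by nlinarith
  have hmain : (V - 1) * c ≤ W * a - b + δ * (2 + 4 * M) * b := by nlinarith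
  have hV1 : 0 < V - 1 := by linarith
  have hcb' : c / b ≤ ((W / (b / a) - 1) + δ * (2 + 4 * M)) / (V - 1) := by
    rw [le_div_iff₀ hV1, div_mul_eq_mul_div, div_le_iff₀ hb]
    have : ((W / (b / a) - 1) + δ * (2 + 4 * M)) * b = W * a - b + δ * (2 + 4 * M) * b := by
      field_simp
    linarith
  have herr : δ * (2 + 4 * M) / (V - 1) * (d / c) ≤ ε := by
    have e1 : d / c ≤ M := (div_le_iff₀ hc).mpr hdc
    have e2 : δ * (2 + 4 * M) / (V - 1) ≤ 2 * (δ * (2 + 4 * M)) := by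
      rw [div_le_iff₀ hV1]
      nlinarith [mul_pos hδ (by linarith : 0 < 2 + 4 * M)]
    calc δ * (2 + 4 * M) / (V - 1) * (d / c) ≤ 2 * (δ * (2 + 4 * M)) * M := by gcongr
      _ = 2 * M * (2 + 4 * M) * δ := by ring
      _ ≤ ε := hδε
  calc d / b = c / b * (d / c) := by field_simp
    _ ≤ ((W / (b / a) - 1) + δ * (2 + 4 * M)) / (V - 1) * (d / c) := by gcongr
    _ = ((W / (b / a) - 1) / (V - 1)) * (d / c) + δ * (2 + 4 * M) / (V - 1) * (d / c) := by ring
    _ ≤ _ := by gcongr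

theorem linearIndependent_of_int_combination {A B : Polynomial ℤ} {q : Polynomial ℚ}
    (hAB : ∀ a b : ℤ, C a * A + C b * B = 0 → a = 0 ∧ b = 0)
    (hq : q ∉ Submodule.span ℚ {ratPoly A, ratPoly B}) :
    LinearIndependent ℚ ![ratPoly A, ratPoly B, q] := by
  have hpair : LinearIndependent ℚ ![ratPoly A, ratPoly B] := by
    rw [← LinearIndependent.iff_fractionRing ℤ ℚ, LinearIndependent.pair_iff]
    intro a b hab
    refine hAB a b (map_injective (Int.castRingHom ℚ) Int.cast_injective ?_)
    simpa [ratPoly, Polynomial.smul_eq_C_mul] using hab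
  have := hpair.finSnoc (x := q) (by simpa [Matrix.range_cons, Set.pair_comm] using hq)
  have hvec : ![ratPoly A, ratPoly B, q] = Fin.snoc ![ratPoly A, ratPoly B] q := by
    funext i
    fin_cases i <;> rfl
  rwa [hvec]

/-- `P_{k-1}, P_k, P_ℓ` are linearly independent and
`log H_ℓ / log H_k ≤ ((w_n(ξ)/τ_k - 1)/(ŵ_n(ξ)-1))·τ_ℓ + ε`. -/
theorem stmt9 (n : ℕ) (hn : 2 ≤ n) (ξ : ℝ) (hξ : Transcendental ℚ ξ)
    (hfin : wHat n ξ < ⊤) (hfin' : wOrd n ξ < ⊤)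
    (P : ℕ → Polynomial ℤ) (hP : IsBestApproxSeq n ξ P)
    (ε : ℝ) (hε : 0 < ε) :
    ∃ k0 : ℕ, ∀ k ≥ k0, polyHeight (P k) > 2 * polyHeight (P (k-1)) →
      ∃ ℓ : ℕ, IsGreatest (ellSet P k) ℓ ∧
        LinearIndependent ℚ ![ratPoly (P (k-1)), ratPoly (P k), ratPoly (P ℓ)] ∧
        Real.log (polyHeight (P ℓ)) / Real.log (polyHeight (P k)) ≤
          (((wOrd n ξ).toReal / tauk P k - 1) / ((wHat n ξ).toReal - 1)) * tauk P ℓ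
            + ε := by
  have hV : (3 / 2 : ℝ) ≤ (wHat n ξ).toReal := by
    have hle : ((3 / 2 : ℝ) : EReal) ≤ wHat n ξ :=
      le_sSup ⟨_, three_halves_mem_uniformExpSet hn hξ, rfl⟩
    simpa only [EReal.toReal_coe] using
      EReal.toReal_le_toReal hle (EReal.coe_ne_bot _) hfin.ne
  have hVcoe : (((wHat n ξ).toReal : ℝ) : EReal) = wHat n ξ := by
    refine EReal.coe_toReal hfin.ne fun h => ?_
    rw [h, EReal.toReal_bot] at hV
    norm_num at hV
  set V := (wHat n ξ).toReal
  set W := (wOrd n ξ).toReal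
  have hM : 0 < 2 * (|W| + 2) * (2 + 4 * (|W| + 2)) := by positivity
  obtain ⟨δ, hδ, hδ4, hδε⟩ : ∃ δ : ℝ, 0 < δ ∧ δ ≤ 1 / 4 ∧
      2 * (|W| + 2) * (2 + 4 * (|W| + 2)) * δ ≤ ε := by
    refine ⟨min (1 / 4) (ε / (2 * (|W| + 2) * (2 + 4 * (|W| + 2)))), by positivity,
      min_le_left _ _, ?_⟩
    rw [mul_comm, ← le_div_iff₀ hM]
    exact min_le_right _ _
  obtain ⟨K₁, hK₁⟩ := eventually_atTop.mp
    (hP.eventually_neg_log_eval_le hξ hfin' (w := W + δ) (by linarith))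
  obtain ⟨K₂, hK₂⟩ := eventually_atTop.mp
    (hP.eventually_le_neg_log_eval hξ (w := V - δ) (by linarith)
      (by rw [← hVcoe]; exact EReal.coe_lt_coe_iff.mpr (by linarith)))
  obtain ⟨K₃, hK₃⟩ := eventually_atTop.mp
    (hP.tendsto_log_height.eventually_ge_atTop (Real.log 4 / δ))
  refine ⟨K₁ + K₂ + K₃ + 3, fun k hk hgap => ?_⟩
  obtain ⟨j, rfl⟩ : ∃ j, k = j + 1 := ⟨k - 1, by omega⟩
  simp only [Nat.add_sub_cancel, tauk] at hgap ⊢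
  have hj : 1 ≤ j := by omega
  -- The exponent inequality holds for every member of `ellSet`, not only for the greatest.
  have hbound : ∀ m, m + 2 ∈ ellSet P (j + 1) → (V - 1 - δ) * Real.log (polyHeight (P (m + 1))) ≤
      (W + δ) * Real.log (polyHeight (P j)) - Real.log (polyHeight (P (j + 1))) + Real.log 4 := by
    rintro m ⟨hm, hspan⟩
    simp only [Nat.add_sub_cancel] at hspan
    have h := hP.eval_mul_height_le hξ hj (m := m) (by omega) hgap
      (hspan m (by omega) (by omega)) (hspan (m + 1) (by omega) (by omega))
    have ne₁ : ∀ i, 1 ≤ i → |aeval ξ (P i)| ≠ 0 := fun i hi =>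
      abs_ne_zero.mpr (aeval_ne_zero_of_transcendental hξ (hP.ne_zero i hi))
    have ne₂ : ∀ i, 1 ≤ i → (polyHeight (P i) : ℝ) ≠ 0 := fun i hi =>
      Nat.cast_ne_zero.mpr (polyHeight_pos (hP.ne_zero i hi)).ne'
    have n₁ := ne₁ j hj
    have n₂ := ne₂ (j + 1) (by omega)
    have n₃ := ne₁ m (by omega)
    have n₄ := ne₂ (m + 1) (by omega)
    have hlog := Real.log_le_log (by positivity) h
    rw [Real.log_mul n₁ n₂, Real.log_mul (by norm_num) (mul_ne_zero n₃ n₄),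
      Real.log_mul n₃ n₄] at hlog
    linarith [hK₁ j (by omega), hK₂ m (by omega)]
  have hmem : j + 2 ∈ ellSet P (j + 1) := by
    refine ⟨le_rfl, fun i h₁ h₂ => ?_⟩
    simp only [Nat.add_sub_cancel] at h₁ ⊢
    obtain rfl | rfl : i = j ∨ i = j + 1 := by omega
    · exact Submodule.subset_span (by simp)
    · exact Submodule.subset_span (by simp)
  have hbdd : BddAbove (ellSet P (j + 1)) := by
    obtain ⟨K, hK⟩ := eventually_atTop.mp (hP.tendsto_log_height.eventually_gt_atTop
      (((W + δ) * Real.log (polyHeight (P j)) - Real.log (polyHeight (P (j + 1))) + Real.log 4) /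
        (V - 1 - δ)))
    refine ⟨K + 1, fun m hm => ?_⟩
    by_contra! hlt
    obtain ⟨i, rfl⟩ : ∃ i, m = i + 2 := ⟨m - 2, by have := hm.1; omega⟩
    have h₁ := hK (i + 1) (by omega)
    rw [div_lt_iff₀ (by linarith)] at h₁
    linarith [hbound i hm]
  have hgreat : IsGreatest (ellSet P (j + 1)) (sSup (ellSet P (j + 1))) :=
    ⟨Nat.sSup_mem ⟨_, hmem⟩ hbdd, fun m hm => le_csSup hbdd hm⟩
  obtain ⟨m, hm⟩ : ∃ m, sSup (ellSet P (j + 1)) = m + 2 :=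
    ⟨sSup (ellSet P (j + 1)) - 2, by have := hgreat.1.1; omega⟩
  rw [hm] at hgreat
  have hjm : j ≤ m := by have := hgreat.1.1; omega
  refine ⟨m + 2, hgreat, ?_, ?_⟩
  · refine linearIndependent_of_int_combination
      (fun a b => hP.eq_zero_of_int_combination hξ hj) fun hspan => ?_
    have : m + 3 ∈ ellSet P (j + 1) := by
      refine ⟨by omega, fun i h₁ h₂ => ?_⟩
      rcases (show i ≤ m + 1 ∨ i = m + 2 by omega) with h | rfl
      · exact hgreat.1.2 i h₁ h
      · exact hspan
    have := hgreat.2 this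
    omega
  · have hlogpos : 0 < Real.log (polyHeight (P j)) := by
      have := hP.le_height hj
      exact Real.log_pos (by exact_mod_cast (show 1 < polyHeight (P j) by omega))
    have hlog4 : Real.log 4 ≤ δ * Real.log (polyHeight (P (j + 1))) := by
      have := hK₃ (j + 1) (by omega)
      rwa [div_le_iff₀ hδ, mul_comm] at this
    exact log_ratio_le_of_exponent_bounds hV hδ hδ4 hδε hlogpos
      (hP.log_height_mono hj (by omega)) (hP.log_height_mono (by omega) (by omega))
      (hlogpos.le.trans (hP.log_height_mono hj (by omega))) hlog4 (hbound m hgreat.1)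
      ((hK₂ (m + 1) (by omega)).trans (hK₁ (m + 1) (by omega)))
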